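/- arXiv:1708.09660 — 2 statements merged into one kernel-verified Lean document; each statement's English description precedes it below -/
import Mathlib

section
/- Let g : I → GLₙ(ℂ) be differentiable on a real interval I, let ν ∈ Mₙ(ℂ) be a constant matrix, and set α = (dg/dz)·g⁻¹, β = g ν g⁻¹, h = g† g. Then (dh/dz)·h⁻¹ = g†(α + α†)(g†)⁻¹ on I; and if in addition the real Nahm equation d(α+α†)/dz = [α,α†] + [β,β†] holds on I, then h satisfies the nonabelian Toda equation d/dz((dh/dz)·h⁻¹) = [h ν h⁻¹, ν†] on I. -/
open Matrix Kronecker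

noncomputable section

attribute [local instance] Matrix.normedAddCommGroup Matrix.normedSpace

/-- n×n complex matrices. -/
abbrev Mat (n : ℕ) := Matrix (Fin n) (Fin n) ℂ

/-- The Levi-Civita symbol on `Fin 3`, valued in `ℂ`. -/
def lev (i j k : Fin 3) : ℂ :=
  ((j.val : ℂ) - i.val) * ((k.val : ℂ) - j.val) * ((k.val : ℂ) - i.val) / 2

/-- The right-hand side of the full Nahm equations:
`[T₄, Tᵢ] + (1/2)·Σ_{j,k} ε_{ijk} [T_j, T_k]`. -/
def nahmRHS {n : ℕ} (T : Fin 3 → ℝ → Mat n) (T4 : ℝ → Mat n) (i : Fin 3) (z : ℝ) : Mat n :=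
  (T4 z * T i z - T i z * T4 z) +
    (1 / 2 : ℂ) • ∑ j : Fin 3, ∑ k : Fin 3, lev i j k • (T j z * T k z - T k z * T j z)

theorem gen_inv {R : Type*} [NormedRing R] [NormedAlgebra ℝ R] [HasSummableGeomSeries R]
    (f : ℝ → R) (f' : R) (z : ℝ) (hf : HasDerivAt f f' z) (hu : IsUnit (f z)) :
    HasDerivAt (fun w => Ring.inverse (f w))
      (-(Ring.inverse (f z) * f' * Ring.inverse (f z))) z := by
  obtain ⟨u, hu⟩ := hu
  have h1 := hasFDerivAt_ringInverse (𝕜 := ℝ) u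
  rw [hu] at h1
  have h2 := h1.comp_hasDerivAt z hf
  rw [← hu, Ring.inverse_unit]
  exact h2

theorem gen_unit {R : Type*} [NormedRing R] [NormedAlgebra ℝ R] [HasSummableGeomSeries R]
    (f : ℝ → R) (f' : R) (z : ℝ) (hf : HasDerivAt f f' z) (hu : IsUnit (f z)) :
    ∀ᶠ w in nhds z, IsUnit (f w) :=
  hf.continuousAt.eventually (Units.isOpen.mem_nhds hu)

theorem gen_mul {R : Type*} [NormedRing R] [NormedAlgebra ℝ R] (f k : ℝ → R) (f' k' : R) (z : ℝ)
    (hf : HasDerivAt f f' z) (hk : HasDerivAt k k' z) :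
    HasDerivAt (fun w => f w * k w) (f' * k z + f z * k') z :=
  hf.mul hk

theorem op_summable (n : ℕ) :
    @HasSummableGeomSeries (Mat n) (Matrix.linftyOpNormedRing : NormedRing (Mat n)) := by
  letI : NormedRing (Mat n) := Matrix.linftyOpNormedRing
  exact @instHasSummableGeomSeriesOfCompleteSpace (Mat n) Matrix.linftyOpNormedRing
    (inferInstanceAs (CompleteSpace (Fin n → Fin n → ℂ)))

theorem aux_mul {n : ℕ} (f k : ℝ → Mat n) (f' k' : Mat n) (z : ℝ)
    (hf : HasDerivAt f f' z) (hk : HasDerivAt k k' z) :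
    HasDerivAt (fun w => f w * k w) (f' * k z + f z * k') z :=
  @gen_mul (Mat n) Matrix.linftyOpNormedRing Matrix.linftyOpNormedAlgebra f k f' k' z hf hk

theorem aux_inv {n : ℕ} (f : ℝ → Mat n) (f' : Mat n) (z : ℝ)
    (hf : HasDerivAt f f' z) (hu : IsUnit (f z)) :
    HasDerivAt (fun w => (f w)⁻¹) (-((f z)⁻¹ * f' * (f z)⁻¹)) z := by
  simp only [Matrix.nonsing_inv_eq_ringInverse]
  exact @gen_inv (Mat n) Matrix.linftyOpNormedRing Matrix.linftyOpNormedAlgebra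
    (op_summable n) f f' z hf hu

theorem aux_unit {n : ℕ} (f : ℝ → Mat n) (f' : Mat n) (z : ℝ)
    (hf : HasDerivAt f f' z) (hu : IsUnit (f z)) : ∀ᶠ w in nhds z, IsUnit (f w) :=
  @gen_unit (Mat n) Matrix.linftyOpNormedRing Matrix.linftyOpNormedAlgebra
    (op_summable n) f f' z hf hu

theorem aux_ct {n : ℕ} (f : ℝ → Mat n) (f' : Mat n) (z : ℝ)
    (hf : HasDerivAt f f' z) : HasDerivAt (fun w => (f w)ᴴ) (f'ᴴ) z := by
  refine hasDerivAt_pi.2 fun i => hasDerivAt_pi.2 fun j => ?_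
  have := hasDerivAt_pi.1 (hasDerivAt_pi.1 hf j) i
  exact this.star

theorem aux_alg {n : ℕ} (g g' : Mat n) (hu : IsUnit g) :
    (g'ᴴ * g + gᴴ * g') * (gᴴ * g)⁻¹
      = gᴴ * (g' * g⁻¹ + (g' * g⁻¹)ᴴ) * (gᴴ)⁻¹ := by
  have hd : IsUnit g.det := (Matrix.isUnit_iff_isUnit_det g).1 hu
  have hd' : IsUnit (gᴴ).det := by rw [Matrix.det_conjTranspose]; exact hd.star
  have e1 : g * g⁻¹ = 1 := Matrix.mul_nonsing_inv g hd
  have e2 : gᴴ * (gᴴ)⁻¹ = 1 := Matrix.mul_nonsing_inv _ hd'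
  rw [Matrix.mul_inv_rev, Matrix.conjTranspose_mul, Matrix.conjTranspose_nonsing_inv]
  calc _ = g'ᴴ * (g * g⁻¹) * (gᴴ)⁻¹ + gᴴ * g' * g⁻¹ * (gᴴ)⁻¹ := by noncomm_ring
    _ = (gᴴ * (gᴴ)⁻¹) * g'ᴴ * (gᴴ)⁻¹ + gᴴ * g' * g⁻¹ * (gᴴ)⁻¹ := by rw [e1, e2]; noncomm_ring
    _ = _ := by noncomm_ring

theorem aux_alg2 {n : ℕ} (g g' ν : Mat n) (hu : IsUnit g) (a b : Mat n)
    (ha : a = g' * g⁻¹) (hb : b = g * ν * g⁻¹) :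
    (g'ᴴ * (a + aᴴ) + gᴴ * ((a * aᴴ - aᴴ * a) + (b * bᴴ - bᴴ * b))) * (gᴴ)⁻¹
      + gᴴ * (a + aᴴ) * (-((gᴴ)⁻¹ * g'ᴴ * (gᴴ)⁻¹))
      = ((gᴴ * g) * ν * (gᴴ * g)⁻¹) * νᴴ - νᴴ * ((gᴴ * g) * ν * (gᴴ * g)⁻¹) := by
  have hd : IsUnit g.det := (Matrix.isUnit_iff_isUnit_det g).1 hu
  have hd' : IsUnit (gᴴ).det := by rw [Matrix.det_conjTranspose]; exact hd.star
  have e2 : gᴴ * (gᴴ)⁻¹ = 1 := Matrix.mul_nonsing_inv _ hd'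
  have ha' : aᴴ = (gᴴ)⁻¹ * g'ᴴ := by
    rw [ha, Matrix.conjTranspose_mul, Matrix.conjTranspose_nonsing_inv]
  have hb' : bᴴ = (gᴴ)⁻¹ * νᴴ * gᴴ := by
    rw [hb, Matrix.conjTranspose_mul, Matrix.conjTranspose_mul,
      Matrix.conjTranspose_nonsing_inv, Matrix.mul_assoc]
  have hg' : g'ᴴ = gᴴ * aᴴ := by
    rw [ha', ← Matrix.mul_assoc, e2, Matrix.one_mul]
  have s1 : (gᴴ)⁻¹ * g'ᴴ * (gᴴ)⁻¹ = aᴴ * (gᴴ)⁻¹ := by rw [ha']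
  rw [s1, hg', Matrix.mul_inv_rev]
  have s2 : gᴴ * (b * bᴴ) * (gᴴ)⁻¹ = gᴴ * g * ν * (g⁻¹ * (gᴴ)⁻¹) * νᴴ := by
    rw [hb', hb]
    calc _ = gᴴ * g * ν * (g⁻¹ * (gᴴ)⁻¹) * νᴴ * (gᴴ * (gᴴ)⁻¹) := by noncomm_ring
      _ = _ := by rw [e2, Matrix.mul_one]
  have s3 : gᴴ * (bᴴ * b) * (gᴴ)⁻¹ = νᴴ * (gᴴ * g * ν * (g⁻¹ * (gᴴ)⁻¹)) := by
    rw [hb', hb]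
    calc _ = (gᴴ * (gᴴ)⁻¹) * νᴴ * (gᴴ * g * ν * (g⁻¹ * (gᴴ)⁻¹)) := by noncomm_ring
      _ = _ := by rw [e2, Matrix.one_mul]
  rw [← s2, ← s3]
  noncomm_ring

/-- With `g : I → GLₙ(ℂ)` differentiable, `ν` constant, `α = (dg/dz)·g⁻¹`,
`β = g ν g⁻¹`, `h = g† g`, one has `(dh/dz)·h⁻¹ = g†(α+α†)(g†)⁻¹` on `I`; and if moreover the
real Nahm equation `d(α+α†)/dz = [α,α†] + [β,β†]` holds on `I`, then `h` satisfies the nonabelian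
Toda equation `d/dz((dh/dz)·h⁻¹) = [h ν h⁻¹, ν†]` on `I`. -/
theorem dhh_and_toda {n : ℕ} (I : Set ℝ)
    (g g' : ℝ → Mat n) (hg : ∀ z ∈ I, HasDerivAt g (g' z) z)
    (hginv : ∀ z ∈ I, IsUnit (g z)) (ν : Mat n) :
    let α : ℝ → Mat n := fun z => g' z * (g z)⁻¹
    let β : ℝ → Mat n := fun z => g z * ν * (g z)⁻¹
    let h : ℝ → Mat n := fun z => (g z)ᴴ * g z
    let h' : ℝ → Mat n := fun z => (g' z)ᴴ * g z + (g z)ᴴ * g' z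
    (∀ z ∈ I, HasDerivAt h (h' z) z ∧
        h' z * (h z)⁻¹ = (g z)ᴴ * (α z + (α z)ᴴ) * ((g z)ᴴ)⁻¹) ∧
      ((∀ z ∈ I, HasDerivAt (fun w => α w + (α w)ᴴ)
            ((α z * (α z)ᴴ - (α z)ᴴ * α z) + (β z * (β z)ᴴ - (β z)ᴴ * β z)) z) →
        ∀ z ∈ I, HasDerivAt (fun w => h' w * (h w)⁻¹)
          ((h z * ν * (h z)⁻¹) * νᴴ - νᴴ * (h z * ν * (h z)⁻¹)) z) := by
  intro α β h h'
  refine ⟨fun z hz => ⟨?_, aux_alg _ _ (hginv z hz)⟩, fun H z hz => ?_⟩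
  · exact aux_mul _ _ _ _ z (aux_ct _ _ z (hg z hz)) (hg z hz)
  · have hc := aux_ct _ _ z (hg z hz)
    have hcu : IsUnit ((g z)ᴴ) := (hginv z hz).star
    have hD := aux_mul _ _ _ _ z (aux_mul _ _ _ _ z hc (H z hz)) (aux_inv _ _ z hc hcu)
    have hev : (fun w => h' w * (h w)⁻¹) =ᶠ[nhds z]
        fun w => (g w)ᴴ * (α w + (α w)ᴴ) * ((g w)ᴴ)⁻¹ := by
      filter_upwards [aux_unit _ _ z (hg z hz) (hginv z hz)] with w hw
      exact aux_alg _ _ hw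
    have hD' := hD.congr_of_eventuallyEq hev
    have e := aux_alg2 (g z) (g' z) ν (hginv z hz) (α z) (β z) rfl rfl
    rw [e] at hD'
    exact hD'
end
end

section
/- Let T₁, T₂, T₃, T₄ : I → Mₙ(ℂ) be differentiable with Tⱼ† = −Tⱼ for j = 1,2,3,4, satisfying the full Nahm equations, and suppose Q(z) is invertible for every z ∈ I. If V : I → M_{2n}(ℂ) is differentiable with dV/dz = [i x₄·1_{2n} + 1₂⊗T₄ − (H+F)]·V on I, then z ↦ V(z)† Q(z)⁻¹ H V(z) is constant on I; and if W : I → M_{2n}(ℂ) is differentiable with dW/dz = [i x₄·1_{2n} + 1₂⊗T₄ + (H+F)]·W on I, then z ↦ W(z)† Q(z) H W(z) is constant on I. -/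
open Matrix Kronecker

noncomputable section

attribute [local instance] Matrix.normedAddCommGroup Matrix.normedSpace

/-- 2n×2n complex matrices, indexed by `Fin 2 × Fin n`. -/
abbrev Mat2 (n : ℕ) := Matrix (Fin 2 × Fin n) (Fin 2 × Fin n) ℂ

/-- The Pauli matrices. -/
def σ : Fin 3 → Matrix (Fin 2) (Fin 2) ℂ :=
  ![!![0, 1; 1, 0], !![0, -Complex.I; Complex.I, 0], !![1, 0; 0, -1]]

/-- `r² = x₁² + x₂² + x₃²`. -/
def r2 (x : Fin 3 → ℝ) : ℝ := ∑ j : Fin 3, x j ^ 2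

/-- `H = −Σ_j x_j σ_j ⊗ 1ₙ`. -/
def Hmat (n : ℕ) (x : Fin 3 → ℝ) : Mat2 n :=
  -∑ j : Fin 3, (x j : ℂ) • (σ j ⊗ₖ (1 : Mat n))

/-- `F(z) = i·Σ_j σ_j ⊗ T_j(z)`. -/
def Fmat {n : ℕ} (T : Fin 3 → ℝ → Mat n) (z : ℝ) : Mat2 n :=
  Complex.I • ∑ j : Fin 3, σ j ⊗ₖ T j z

/-- `Q(z) = (1/r²)·H·F(z)·H − F(z)`. -/
def Qmat {n : ℕ} (x : Fin 3 → ℝ) (T : Fin 3 → ℝ → Mat n) (z : ℝ) : Mat2 n :=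
  ((r2 x : ℂ))⁻¹ • (Hmat n x * Fmat T z * Hmat n x) - Fmat T z

theorem hasDerivAt_entry {m : Type} [Fintype m] {f : ℝ → Matrix m m ℂ} {f' : Matrix m m ℂ}
    {z : ℝ} : HasDerivAt f f' z ↔ ∀ i j, HasDerivAt (fun t => f t i j) (f' i j) z :=
  (hasDerivAt_pi (φ := fun t i => f t i)).trans (forall_congr' fun _ => hasDerivAt_pi)

theorem hasDerivAt_matmul {m : Type} [Fintype m] {f g : ℝ → Matrix m m ℂ} {f' g' : Matrix m m ℂ}
    {z : ℝ} (hf : HasDerivAt f f' z) (hg : HasDerivAt g g' z) :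
    HasDerivAt (fun t => f t * g t) (f' * g z + f z * g') z := by
  rw [hasDerivAt_entry] at *
  intro i j
  simp only [Matrix.mul_apply, Matrix.add_apply, ← Finset.sum_add_distrib]
  exact HasDerivAt.fun_sum fun k _ => (hf i k).mul (hg k j)

theorem hasDerivAt_ct {m : Type} [Fintype m] {f : ℝ → Matrix m m ℂ} {f' : Matrix m m ℂ}
    {z : ℝ} (hf : HasDerivAt f f' z) : HasDerivAt (fun t => (f t)ᴴ) (f'ᴴ) z := by
  rw [hasDerivAt_entry] at *
  intro i j
  simpa only [Matrix.conjTranspose_apply] using (hf j i).star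

theorem hasDerivAt_matinv {m : Type} [Fintype m] [DecidableEq m] {f : ℝ → Matrix m m ℂ}
    {f' : Matrix m m ℂ} {z : ℝ} (hf : HasDerivAt f f' z) (hu : IsUnit (f z)) :
    HasDerivAt (fun t => (f t)⁻¹) (-((f z)⁻¹ * f' * (f z)⁻¹)) z := by
  have hdet : (f z).det ≠ 0 := ((Matrix.isUnit_iff_isUnit_det _).1 hu).ne_zero
  have hc : ContinuousAt f z := hf.continuousAt
  have hinv : ContinuousAt (fun t => (f t)⁻¹) z := by
    refine ContinuousAt.comp (g := Inv.inv) ?_ hc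
    apply continuousAt_matrix_inv
    rw [Ring.inverse_eq_inv']
    exact continuousAt_inv₀ hdet
  have hev : ∀ᶠ t in nhds z, (f t).det ≠ 0 := by
    have : ContinuousAt (fun t => (f t).det) z :=
      (Continuous.matrix_det continuous_id).continuousAt.comp hc
    exact this.eventually_ne hdet
  replace hf := hasDerivAt_iff_tendsto_slope.1 hf
  refine hasDerivAt_iff_tendsto_slope.2 ?_
  have h1 : Filter.Tendsto (fun t => -((f t)⁻¹ * slope f z t * (f z)⁻¹)) (nhdsWithin z {z}ᶜ)
      (nhds (-((f z)⁻¹ * f' * (f z)⁻¹))) := by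
    have h2 := hinv.tendsto.mono_left (nhdsWithin_le_nhds (s := {z}ᶜ))
    exact ((h2.mul hf).mul tendsto_const_nhds).neg
  refine h1.congr' ?_
  filter_upwards [hev.filter_mono nhdsWithin_le_nhds] with t ht
  have e1 : (f t)⁻¹ * f t = 1 := Matrix.nonsing_inv_mul _ (isUnit_iff_ne_zero.2 ht)
  have e2 : f z * (f z)⁻¹ = 1 := Matrix.mul_nonsing_inv _ (isUnit_iff_ne_zero.2 hdet)
  simp only [slope_def_module, Matrix.mul_smul, Matrix.smul_mul, ← smul_neg]
  congr 1
  rw [mul_sub, sub_mul, e1, mul_assoc, e2]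
  simp

theorem const_of_deriv_zero {m : Type} [Fintype m] {I : Set ℝ} (hI : I.OrdConnected)
    {f : ℝ → Matrix m m ℂ} (hf : ∀ z ∈ I, HasDerivAt f 0 z) :
    ∀ z ∈ I, ∀ w ∈ I, f z = f w := by
  intro z hz w hw
  ext i j
  have h := Convex.norm_image_sub_le_of_norm_hasDerivWithin_le (f := fun t => f t i j)
    (f' := fun _ => 0) (C := 0) (s := I)
    (fun t ht => ((hasDerivAt_entry.1 (hf t ht)) i j).hasDerivWithinAt) (by simp)
    hI.convex hw hz
  simpa [sub_eq_zero] using h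

theorem kron_neg {n : ℕ} (A : Matrix (Fin 2) (Fin 2) ℂ) (B : Mat n) :
    A ⊗ₖ (-B) = -(A ⊗ₖ B) := by
  ext ⟨a, i⟩ ⟨b, j⟩
  simp

theorem s00 : σ 0 * σ 0 = 1 := by
  ext i j; fin_cases i <;> fin_cases j <;> simp [σ]
theorem s11 : σ 1 * σ 1 = 1 := by
  ext i j; fin_cases i <;> fin_cases j <;> simp [σ]
theorem s22 : σ 2 * σ 2 = 1 := by
  ext i j; fin_cases i <;> fin_cases j <;> simp [σ]
theorem s01 : σ 0 * σ 1 = Complex.I • σ 2 := by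
  ext i j; fin_cases i <;> fin_cases j <;> simp [σ]
theorem s10 : σ 1 * σ 0 = -Complex.I • σ 2 := by
  ext i j; fin_cases i <;> fin_cases j <;> simp [σ]
theorem s12 : σ 1 * σ 2 = Complex.I • σ 0 := by
  ext i j; fin_cases i <;> fin_cases j <;> simp [σ]
theorem s21 : σ 2 * σ 1 = -Complex.I • σ 0 := by
  ext i j; fin_cases i <;> fin_cases j <;> simp [σ]
theorem s20 : σ 2 * σ 0 = Complex.I • σ 1 := by
  ext i j; fin_cases i <;> fin_cases j <;> simp [σ]
theorem s02 : σ 0 * σ 2 = -Complex.I • σ 1 := by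
  ext i j; fin_cases i <;> fin_cases j <;> simp [σ]
theorem sct (j : Fin 3) : (σ j)ᴴ = σ j := by
  ext a b; fin_cases j <;> fin_cases a <;> fin_cases b <;> simp [σ]

theorem H_sq (n : ℕ) (x : Fin 3 → ℝ) : Hmat n x * Hmat n x = (r2 x : ℂ) • 1 := by
  simp only [Hmat, r2, Fin.sum_univ_three, neg_mul_neg, mul_add, add_mul, Matrix.smul_mul,
    Matrix.mul_smul, ← Matrix.mul_kronecker_mul, s00, s01, s02, s10, s11, s12, s20, s21, s22,
    Matrix.smul_kronecker, mul_one, Matrix.one_kronecker_one]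
  push_cast
  module

theorem H_comm (n : ℕ) (x : Fin 3 → ℝ) (M : Mat n) :
    Hmat n x * ((1 : Matrix (Fin 2) (Fin 2) ℂ) ⊗ₖ M) =
      ((1 : Matrix (Fin 2) (Fin 2) ℂ) ⊗ₖ M) * Hmat n x := by
  simp only [Hmat, neg_mul, mul_neg, Finset.sum_mul, Finset.mul_sum, Matrix.smul_mul,
    Matrix.mul_smul, ← Matrix.mul_kronecker_mul, one_mul, mul_one]

theorem H_ct (n : ℕ) (x : Fin 3 → ℝ) : (Hmat n x)ᴴ = Hmat n x := by
  simp [Hmat, Matrix.conjTranspose_sum, Matrix.conjTranspose_smul,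
    Matrix.conjTranspose_kronecker, sct]

theorem F_ct {n : ℕ} (T : Fin 3 → ℝ → Mat n) (z : ℝ) (h : ∀ j, (T j z)ᴴ = - T j z) :
    (Fmat T z)ᴴ = Fmat T z := by
  simp only [Fmat, Fin.sum_univ_three, Matrix.conjTranspose_add, Matrix.conjTranspose_smul,
    Matrix.conjTranspose_kronecker, sct, h, kron_neg]
  simp

theorem F_deriv {n : ℕ} (T : Fin 3 → ℝ → Mat n) (T4 : ℝ → Mat n) (z : ℝ)
    (h : ∀ i, HasDerivAt (T i) (nahmRHS T T4 i z) z) :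
    HasDerivAt (Fmat T) (((1 : Matrix (Fin 2) (Fin 2) ℂ) ⊗ₖ T4 z) * Fmat T z
      - Fmat T z * ((1 : Matrix (Fin 2) (Fin 2) ℂ) ⊗ₖ T4 z) - Fmat T z * Fmat T z
      - (1 : Matrix (Fin 2) (Fin 2) ℂ) ⊗ₖ (∑ j, T j z * T j z)) z := by
  have h1 : HasDerivAt (Fmat T) (Complex.I • ∑ j : Fin 3, σ j ⊗ₖ nahmRHS T T4 j z) z := by
    rw [hasDerivAt_entry]
    rintro ⟨a, i⟩ ⟨b, j⟩
    have h2 := fun k => hasDerivAt_entry.1 (h k) i j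
    simp only [Fmat, Matrix.smul_apply, Matrix.sum_apply, Matrix.kroneckerMap_apply]
    exact (HasDerivAt.fun_sum fun k _ => (h2 k).const_mul (σ k a b)).const_smul Complex.I
  convert h1 using 1
  simp only [Fmat, nahmRHS, lev, Fin.sum_univ_three, mul_add, add_mul, Matrix.smul_mul,
    Matrix.mul_smul, ← Matrix.mul_kronecker_mul, s00, s01, s02, s10, s11, s12, s20, s21, s22,
    Matrix.smul_kronecker, mul_one, one_mul, Matrix.kronecker_add, Matrix.kronecker_smul,
    sub_eq_add_neg, kron_neg]
  norm_num
  match_scalars <;> ring_nf <;> simp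

theorem alg_C {R : Type*} [Ring R] (H F A S : R) (hA : H * A = A * H) (hS : H * S = S * H)
    (hH : H * H * F = F * (H * H)) :
    (-A + (H + F)) * (H * F - F * H)
      + (H * (A * F - F * A - F * F - S) - (A * F - F * A - F * F - S) * H)
      + (H * F - F * H) * (A + (H + F)) = 0 := by
  have e1 : H * (A * F) = A * (H * F) := by rw [← mul_assoc, hA, mul_assoc]
  have e2 : F * (H * A) = F * (A * H) := by rw [hA]
  have e3 : H * (H * F) = F * (H * H) := by rw [← hH, mul_assoc]
  simp only [mul_add, add_mul, mul_sub, sub_mul, neg_mul, mul_assoc, e1, e2, e3, hS]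
  abel

theorem alg_D {R : Type*} [Ring R] (A B C C' D : R) (h1 : C * D = 1) (h2 : D * C = 1)
    (h : (-A + B) * C + C' + C * (A + B) = 0) :
    (-A - B) * D + -(D * C' * D) + D * (A - B) = 0 := by
  have e : C' = -((-A + B) * C) - C * (A + B) := by
    rw [← sub_eq_zero, ← h]; abel
  have e1 : D * C' * D = D * (A - B) - (A + B) * D := by
    calc D * C' * D = D * (A - B) * (C * D) - (D * C) * (A + B) * D := by rw [e]; noncomm_ring
      _ = _ := by rw [h1, h2]; simp
  rw [e1]
  noncomm_ring

/-- Theorem `constancythm`: with skew-adjoint Nahm data and `Q(z)` invertible, any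
solution `V` of `dV/dz = [i x₄ + 1₂⊗T₄ − (H+F)]V` has `V† Q⁻¹ H V` constant on `I`, and any
solution `W` of `dW/dz = [i x₄ + 1₂⊗T₄ + (H+F)]W` has `W† Q H W` constant on `I`. -/
theorem constancy_of_hermitian_pairings {n : ℕ} (I : Set ℝ) (hI : I.OrdConnected)
    (T1 T2 T3 T4 : ℝ → Mat n)
    (hsk1 : ∀ z ∈ I, (T1 z)ᴴ = -T1 z) (hsk2 : ∀ z ∈ I, (T2 z)ᴴ = -T2 z)
    (hsk3 : ∀ z ∈ I, (T3 z)ᴴ = -T3 z) (hsk4 : ∀ z ∈ I, (T4 z)ᴴ = -T4 z)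
    (x : Fin 3 → ℝ) (hx : r2 x ≠ 0) (x4 : ℝ)
    (hnahm : ∀ z ∈ I, ∀ i : Fin 3,
      HasDerivAt (![T1, T2, T3] i) (nahmRHS ![T1, T2, T3] T4 i z) z)
    (hQ : ∀ z ∈ I, IsUnit (Qmat x ![T1, T2, T3] z)) :
    let T : Fin 3 → ℝ → Mat n := ![T1, T2, T3]
    let H : Mat2 n := Hmat n x
    let Fm : ℝ → Mat2 n := Fmat T
    let Q : ℝ → Mat2 n := Qmat x T
    let Aminus : ℝ → Mat2 n := fun z =>
      (Complex.I * (x4 : ℂ)) • (1 : Mat2 n) + (1 : Matrix (Fin 2) (Fin 2) ℂ) ⊗ₖ T4 z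
        - (H + Fm z)
    let Aplus : ℝ → Mat2 n := fun z =>
      (Complex.I * (x4 : ℂ)) • (1 : Mat2 n) + (1 : Matrix (Fin 2) (Fin 2) ℂ) ⊗ₖ T4 z
        + (H + Fm z)
    (∀ V : ℝ → Mat2 n, (∀ z ∈ I, HasDerivAt V (Aminus z * V z) z) →
      ∀ z ∈ I, ∀ w ∈ I, (V z)ᴴ * (Q z)⁻¹ * H * V z = (V w)ᴴ * (Q w)⁻¹ * H * V w) ∧
    (∀ W : ℝ → Mat2 n, (∀ z ∈ I, HasDerivAt W (Aplus z * W z) z) →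
      ∀ z ∈ I, ∀ w ∈ I, (W z)ᴴ * Q z * H * W z = (W w)ᴴ * Q w * H * W w) := by
  intro T H Fm Q Aminus Aplus
  have hsk : ∀ z ∈ I, ∀ j, (T j z)ᴴ = - T j z := by
    intro z hz j
    fin_cases j
    · exact hsk1 z hz
    · exact hsk2 z hz
    · exact hsk3 z hz
  have hr : (r2 x : ℂ) ≠ 0 := by exact_mod_cast hx
  have hHH : H * H = (r2 x : ℂ) • 1 := H_sq n x
  have hHct : Hᴴ = H := H_ct n x
  have hFct : ∀ z ∈ I, (Fm z)ᴴ = Fm z := fun z hz => F_ct T z (hsk z hz)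
  have hQH : ∀ z, Q z * H = H * Fm z - Fm z * H := by
    intro z
    change ((r2 x : ℂ)⁻¹ • (H * Fm z * H) - Fm z) * H = _
    rw [sub_mul, Matrix.smul_mul, mul_assoc, hHH, Matrix.mul_smul, mul_one, smul_smul,
      inv_mul_cancel₀ hr, one_smul]
  have hHQ : ∀ z, H * Q z = -(Q z * H) := by
    intro z
    rw [hQH]
    change H * ((r2 x : ℂ)⁻¹ • (H * Fm z * H) - Fm z) = _
    rw [mul_sub, Matrix.mul_smul, ← mul_assoc, ← mul_assoc, hHH, Matrix.smul_mul,
      Matrix.smul_mul, one_mul, smul_smul, inv_mul_cancel₀ hr, one_smul]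
    abel
  set C : ℝ → Mat2 n := fun z => H * Fm z - Fm z * H with hC
  set A : ℝ → Mat2 n := fun z =>
    (Complex.I * (x4 : ℂ)) • (1 : Mat2 n) + (1 : Matrix (Fin 2) (Fin 2) ℂ) ⊗ₖ T4 z with hAdef
  have hHA : ∀ z, H * A z = A z * H := by
    intro z
    have := H_comm n x (T4 z)
    simp only [hAdef, mul_add, add_mul, Matrix.mul_smul, Matrix.smul_mul, mul_one, one_mul]
    rw [show H * _ = _ from this]
  have hAct : ∀ z ∈ I, (A z)ᴴ = - A z := by
    intro z hz
    simp only [hAdef, Matrix.conjTranspose_add, Matrix.conjTranspose_smul,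
      Matrix.conjTranspose_kronecker, hsk4 z hz, kron_neg, Matrix.conjTranspose_one]
    simp
    abel
  have hCd : ∀ z ∈ I, ∃ C', HasDerivAt C C' z ∧
      (-A z + (H + Fm z)) * C z + C' + C z * (A z + (H + Fm z)) = 0 := by
    intro z hz
    have hF := F_deriv T T4 z (hnahm z hz)
    have hcH := hasDerivAt_const z H
    have h1 := (hasDerivAt_matmul hcH hF).sub (hasDerivAt_matmul hF hcH)
    refine ⟨_, h1, ?_⟩
    have hS := H_comm n x (∑ j, T j z * T j z)
    have key := alg_C H (Fm z) (A z) _ (hHA z) hS (by rw [hHH]; simp)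
    refine Eq.trans ?_ key
    have e : (1 : Matrix (Fin 2) (Fin 2) ℂ) ⊗ₖ T4 z * Fmat T z
        - Fmat T z * (1 : Matrix (Fin 2) (Fin 2) ℂ) ⊗ₖ T4 z = A z * Fm z - Fm z * A z := by
      simp only [hAdef, mul_add, add_mul, Matrix.mul_smul, Matrix.smul_mul, mul_one, one_mul]
      simp only [Fm]
      abel
    rw [e]
    simp only [zero_mul, mul_zero, zero_add, add_zero]
    rfl
  constructor
  · intro V hV
    have hD : ∀ z ∈ I, C z * (C z)⁻¹ = 1 ∧ (C z)⁻¹ * C z = 1 ∧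
        (Q z)⁻¹ * H = -(r2 x : ℂ) • (C z)⁻¹ ∧ IsUnit (C z) := by
      intro z hz
      have hq : IsUnit (Q z).det := (Matrix.isUnit_iff_isUnit_det _).1 (hQ z hz)
      have q1 := Matrix.mul_nonsing_inv _ hq
      have q2 := Matrix.nonsing_inv_mul _ hq
      have hCQ : C z = Q z * H := (hQH z).symm
      have hm : C z * ((-(r2 x : ℂ))⁻¹ • ((Q z)⁻¹ * H)) = 1 := by
        rw [hCQ, ← neg_eq_iff_eq_neg.2 (hHQ z).symm.symm, Matrix.mul_smul, neg_mul, ← mul_assoc,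
          mul_assoc H, q1, mul_one, hHH, ← neg_smul, smul_smul, inv_mul_cancel₀ (neg_ne_zero.2 hr),
          one_smul]
      have hinv := Matrix.inv_eq_right_inv hm
      refine ⟨by rw [hinv, hm], ?_, ?_, ?_⟩
      · rw [hinv]; exact mul_eq_one_comm.1 hm
      · rw [hinv, smul_smul, mul_inv_cancel₀ (neg_ne_zero.2 hr), one_smul]
      · exact IsUnit.of_mul_eq_one _ hm
    have hconst : ∀ z ∈ I, ∀ w ∈ I, (V z)ᴴ * (C z)⁻¹ * V z = (V w)ᴴ * (C w)⁻¹ * V w := by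
      apply const_of_deriv_zero hI
      intro z hz
      obtain ⟨C', hC', hz0⟩ := hCd z hz
      obtain ⟨c1, c2, -, hu⟩ := hD z hz
      have h := hasDerivAt_matmul (hasDerivAt_matmul (hasDerivAt_ct (hV z hz))
        (hasDerivAt_matinv hC' hu)) (hV z hz)
      have key := alg_D (A z) (H + Fm z) (C z) C' (C z)⁻¹ c1 c2 hz0
      have hct : (Aminus z * V z)ᴴ = (V z)ᴴ * (-A z - (H + Fm z)) := by
        change ((A z - (H + Fm z)) * V z)ᴴ = _
        rw [Matrix.conjTranspose_mul, Matrix.conjTranspose_sub, Matrix.conjTranspose_add H, hAct z hz,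
          hHct, hFct z hz]
      rw [hct, show Aminus z = A z - (H + Fm z) from rfl] at h
      convert h using 1
      calc (0 : Mat2 n) = (V z)ᴴ * ((-A z - (H + Fm z)) * (C z)⁻¹ + -((C z)⁻¹ * C' * (C z)⁻¹)
            + (C z)⁻¹ * (A z - (H + Fm z))) * V z := by rw [key]; simp
        _ = _ := by simp only [mul_add, add_mul, mul_assoc]
    intro z hz w hw
    rw [mul_assoc (V z)ᴴ, mul_assoc (V w)ᴴ, (hD z hz).2.2.1, (hD w hw).2.2.1,
      Matrix.mul_smul, Matrix.mul_smul, Matrix.smul_mul, Matrix.smul_mul, hconst z hz w hw]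
  · intro W hW
    have hconst : ∀ z ∈ I, ∀ w ∈ I, (W z)ᴴ * C z * W z = (W w)ᴴ * C w * W w := by
      apply const_of_deriv_zero hI
      intro z hz
      obtain ⟨C', hC', hz0⟩ := hCd z hz
      have h := hasDerivAt_matmul (hasDerivAt_matmul (hasDerivAt_ct (hW z hz)) hC') (hW z hz)
      have hct : (Aplus z * W z)ᴴ = (W z)ᴴ * (-A z + (H + Fm z)) := by
        change ((A z + (H + Fm z)) * W z)ᴴ = _
        rw [Matrix.conjTranspose_mul, Matrix.conjTranspose_add (A z), Matrix.conjTranspose_add H, hAct z hz,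
          hHct, hFct z hz]
      rw [hct, show Aplus z = A z + (H + Fm z) from rfl] at h
      convert h using 1
      calc (0 : Mat2 n) = (W z)ᴴ * ((-A z + (H + Fm z)) * C z + C'
            + C z * (A z + (H + Fm z))) * W z := by rw [hz0]; simp
        _ = _ := by simp only [mul_add, add_mul, mul_assoc]
    intro z hz w hw
    rw [mul_assoc (W z)ᴴ, mul_assoc (W w)ᴴ, hQH, hQH]
    exact hconst z hz w hw
end
end
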